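/- For any c > 0, with probability at least 1 − p^(−c) over the Gaussian noise z, simultaneously for every subset J ⊆ {1,…,p} with J ≠ J⋆, writing s = |J| and t = |J ∩ J⋆|: z^⊤(P_J − P_{J⋆})z ≤ (20 + 4c)·σ²·(max(s, s⋆) − t)·log p. -/

import Mathlib

open MeasureTheory ProbabilityTheory Finset
open scoped Classical ENNReal

section GaussianTail

lemma lintegral_exp_sq_div_four_gaussianReal :
    ∫⁻ x, ENNReal.ofReal (Real.exp (x ^ 2 / 4)) ∂(gaussianReal 0 1) =
      ENNReal.ofReal (Real.sqrt 2) := by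
  have hpdf (x : ℝ) : gaussianPDF 0 1 x * ENNReal.ofReal (Real.exp (x ^ 2 / 4)) =
      ENNReal.ofReal (Real.sqrt 2) * gaussianPDF 0 2 x := by
    simp only [gaussianPDF, gaussianPDFReal, NNReal.coe_one, NNReal.coe_ofNat, sub_zero]
    rw [← ENNReal.ofReal_mul (by positivity), ← ENNReal.ofReal_mul (by positivity)]
    congr 1
    rw [mul_assoc, ← Real.exp_add, show 2 * Real.pi * 2 = 2 * (2 * Real.pi * 1) by ring,
      Real.sqrt_mul (by norm_num) (2 * Real.pi * 1), mul_inv, ← mul_assoc, ← mul_assoc,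
      mul_inv_cancel₀ (by positivity), one_mul]
    congr 2
    ring
  rw [gaussianReal_of_var_ne_zero _ one_ne_zero,
    lintegral_withDensity_eq_lintegral_mul _ (measurable_gaussianPDF _ _) (by fun_prop)]
  simp only [Pi.mul_apply, hpdf]
  rw [lintegral_const_mul _ (measurable_gaussianPDF _ _),
    lintegral_gaussianPDF_eq_one _ two_ne_zero, mul_one]

variable {E : Type*} [NormedAddCommGroup E] [InnerProductSpace ℝ E] [FiniteDimensional ℝ E]
  [MeasurableSpace E] [BorelSpace E]

lemma lintegral_exp_norm_sq_div_four_stdGaussian :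
    ∫⁻ x, ENNReal.ofReal (Real.exp (‖x‖ ^ 2 / 4)) ∂(stdGaussian E) =
      ENNReal.ofReal (Real.sqrt 2 ^ Module.finrank ℝ E) := by
  have hnorm (x : Fin (Module.finrank ℝ E) → ℝ) :
      ENNReal.ofReal (Real.exp (‖∑ i, x i • stdOrthonormalBasis ℝ E i‖ ^ 2 / 4)) =
        ∏ i, ENNReal.ofReal (Real.exp (x i ^ 2 / 4)) := by
    rw [← ENNReal.ofReal_prod_of_nonneg (fun _ _ ↦ (Real.exp_pos _).le), ← Real.exp_sum,
      ← Finset.sum_div, ← (stdOrthonormalBasis ℝ E).sum_sq_inner_right]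
    simp [inner_sum, inner_smul_right, (stdOrthonormalBasis ℝ E).inner_eq_ite]
  rw [stdGaussian, lintegral_map (by fun_prop) (by fun_prop)]
  simp only [hnorm]
  rw [lintegral_prod_eq_prod_lintegral_of_indepFun Finset.univ
    (fun i (x : Fin (Module.finrank ℝ E) → ℝ) ↦ ENNReal.ofReal (Real.exp (x i ^ 2 / 4)))
    (iIndepFun_pi (X := fun _ (y : ℝ) ↦ ENNReal.ofReal (Real.exp (y ^ 2 / 4)))
      (fun _ ↦ by fun_prop)) (fun _ ↦ by fun_prop)]
  have heval (i : Fin (Module.finrank ℝ E)) :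
      ∫⁻ x : Fin (Module.finrank ℝ E) → ℝ, ENNReal.ofReal (Real.exp (x i ^ 2 / 4))
        ∂(Measure.pi fun _ ↦ gaussianReal 0 1) = ENNReal.ofReal (Real.sqrt 2) := by
    rw [← lintegral_exp_sq_div_four_gaussianReal]
    exact (measurePreserving_eval (fun _ : Fin (Module.finrank ℝ E) ↦ gaussianReal 0 1)
      i).lintegral_comp (f := fun y : ℝ ↦ ENNReal.ofReal (Real.exp (y ^ 2 / 4))) (by fun_prop)
  simp only [heval]
  rw [Finset.prod_const, Finset.card_univ, Fintype.card_fin,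
    ENNReal.ofReal_pow (Real.sqrt_nonneg _)]

lemma stdGaussian_map_orthogonalProjectionOnto (W : Submodule ℝ E) :
    (stdGaussian E).map W.orthogonalProjectionOnto = stdGaussian W := by
  have : IsProbabilityMeasure ((stdGaussian E).map W.orthogonalProjectionOnto) :=
    Measure.isProbabilityMeasure_map (by fun_prop)
  apply Measure.ext_of_charFunDual
  ext L
  rw [charFunDual_map, charFunDual_stdGaussian, charFunDual_stdGaussian]
  suffices ‖L.comp W.orthogonalProjectionOnto‖ = ‖L‖ by rw [this]
  refine le_antisymm ?_ ?_
  · refine (ContinuousLinearMap.opNorm_comp_le _ _).trans ?_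
    exact mul_le_of_le_one_right (norm_nonneg _) W.orthogonalProjectionOnto_norm_le
  · refine ContinuousLinearMap.opNorm_le_bound _ (norm_nonneg _) fun w ↦ ?_
    simpa using (L.comp W.orthogonalProjectionOnto).le_opNorm (w : E)

lemma stdGaussian_lt_norm_sq_starProjection_le (W : Submodule ℝ E) (a : ℝ) :
    stdGaussian E {x | a < ‖W.starProjection x‖ ^ 2} ≤
      ENNReal.ofReal (Real.sqrt 2 ^ Module.finrank ℝ W * Real.exp (-(a / 4))) := by
  have hint : ∫⁻ x, ENNReal.ofReal (Real.exp (‖W.starProjection x‖ ^ 2 / 4)) ∂(stdGaussian E) =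
      ENNReal.ofReal (Real.sqrt 2 ^ Module.finrank ℝ W) := by
    rw [← lintegral_exp_norm_sq_div_four_stdGaussian, ← stdGaussian_map_orthogonalProjectionOnto,
      lintegral_map (by fun_prop) (by fun_prop)]
    rfl
  calc stdGaussian E {x | a < ‖W.starProjection x‖ ^ 2}
      ≤ stdGaussian E {x | ENNReal.ofReal (Real.exp (a / 4)) ≤
          ENNReal.ofReal (Real.exp (‖W.starProjection x‖ ^ 2 / 4))} := by
        refine measure_mono fun x hx ↦ ?_
        simp only [Set.mem_ofPred_eq] at hx ⊢
        gcongr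
    _ ≤ (∫⁻ x, ENNReal.ofReal (Real.exp (‖W.starProjection x‖ ^ 2 / 4)) ∂(stdGaussian E)) /
          ENNReal.ofReal (Real.exp (a / 4)) :=
        meas_ge_le_lintegral_div (by fun_prop)
          (ENNReal.ofReal_pos.2 (Real.exp_pos _)).ne' ENNReal.ofReal_ne_top
    _ = _ := by
        rw [hint, ← ENNReal.ofReal_div_of_pos (Real.exp_pos _), Real.exp_neg, div_eq_mul_inv]

lemma pi_gaussianReal_lt_norm_sq_starProjection_le {ι : Type*} [Fintype ι] {σ : ℝ} (hσ : 0 < σ)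
    (W : Submodule ℝ (EuclideanSpace ℝ ι)) (a : ℝ) :
    Measure.pi (fun _ : ι ↦ gaussianReal 0 (Real.toNNReal (σ ^ 2)))
        {z | σ ^ 2 * a < ‖W.starProjection (WithLp.toLp 2 z)‖ ^ 2} ≤
      ENNReal.ofReal (Real.sqrt 2 ^ Module.finrank ℝ W * Real.exp (-(a / 4))) := by
  have hmap : Measure.pi (fun _ : ι ↦ gaussianReal 0 (Real.toNNReal (σ ^ 2))) =
      (Measure.pi (fun _ : ι ↦ gaussianReal 0 1)).map (fun x i ↦ σ * x i) := by
    rw [Measure.pi_map_pi (f := fun _ y ↦ σ * y) (fun _ ↦ by fun_prop)]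
    congr 1
    ext1 i
    rw [gaussianReal_map_const_mul, mul_zero, mul_one]
    congr 1
    ext
    simp [sq_nonneg]
  have hmeas (b : ℝ) : MeasurableSet {x | b < ‖W.starProjection x‖ ^ 2} :=
    measurableSet_lt measurable_const (by fun_prop)
  refine le_trans (le_of_eq ?_) (stdGaussian_lt_norm_sq_starProjection_le W a)
  have hmeas' : MeasurableSet
      {z : ι → ℝ | σ ^ 2 * a < ‖W.starProjection (WithLp.toLp 2 z)‖ ^ 2} :=
    (WithLp.measurable_toLp 2 _) (hmeas _)
  rw [hmap, ← map_pi_eq_stdGaussian, Measure.map_apply (by fun_prop) (hmeas a),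
    Measure.map_apply (by fun_prop) hmeas']
  congr 1
  ext x
  simp only [Set.mem_preimage, Set.mem_ofPred_eq]
  rw [show WithLp.toLp 2 (fun i ↦ σ * x i) = σ • WithLp.toLp 2 x from rfl, map_smul, norm_smul,
    mul_pow, Real.norm_eq_abs, sq_abs]
  exact mul_lt_mul_iff_right₀ (by positivity)

end GaussianTail

section Projection

variable {E : Type*} [NormedAddCommGroup E] [InnerProductSpace ℝ E] [FiniteDimensional ℝ E]

lemma norm_sq_starProjection_eq_add {K₁ K₂ : Submodule ℝ E} (h : K₁ ≤ K₂) (x : E) :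
    ‖K₂.starProjection x‖ ^ 2 =
      ‖K₁.starProjection x‖ ^ 2 + ‖(K₁ᗮ ⊓ K₂).starProjection x‖ ^ 2 := by
  have h₁ (w : E) (hw : w ∈ K₁) : inner ℝ (x - K₁.starProjection x) w = 0 :=
    K₁.starProjection_inner_eq_zero x w hw
  have h₂ (w : E) (hw : w ∈ K₂) : inner ℝ (x - K₂.starProjection x) w = 0 :=
    K₂.starProjection_inner_eq_zero x w hw
  have hdiff : (K₁ᗮ ⊓ K₂).starProjection x = K₂.starProjection x - K₁.starProjection x := by
    refine Submodule.eq_starProjection_of_mem_of_inner_eq_zero ⟨?_, ?_⟩ fun w hw ↦ ?_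
    · refine (Submodule.mem_orthogonal' _ _).2 fun w hw ↦ ?_
      have e₁ := h₁ w hw
      have e₂ := h₂ w (h hw)
      simp only [inner_sub_left] at e₁ e₂ ⊢
      linarith
    · exact K₂.sub_mem (K₂.starProjection_apply_mem x) (h (K₁.starProjection_apply_mem x))
    · have e₂ := h₂ w hw.2
      have e₃ := (Submodule.mem_orthogonal _ _).1 hw.1 _ (K₁.starProjection_apply_mem x)
      simp only [inner_sub_left] at e₂ e₃ ⊢
      linarith
  have horth : inner ℝ (K₁.starProjection x) ((K₁ᗮ ⊓ K₂).starProjection x) = 0 :=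
    (Submodule.mem_orthogonal _ _).1 ((K₁ᗮ ⊓ K₂).starProjection_apply_mem x).1 _
      (K₁.starProjection_apply_mem x)
  have hsum : K₂.starProjection x =
      K₁.starProjection x + (K₁ᗮ ⊓ K₂).starProjection x := by rw [hdiff]; abel
  rw [hsum, norm_add_sq_real, horth]
  ring

lemma norm_sq_starProjection_sub_le {K₁ K₂ K₃ : Submodule ℝ E} (h₂ : K₁ ≤ K₂) (h₃ : K₁ ≤ K₃)
    (x : E) :
    ‖K₂.starProjection x‖ ^ 2 - ‖K₃.starProjection x‖ ^ 2 ≤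
      ‖(K₁ᗮ ⊓ K₂).starProjection x‖ ^ 2 := by
  have e₂ := norm_sq_starProjection_eq_add h₂ x
  have e₃ := norm_sq_starProjection_eq_add h₃ x
  linarith [sq_nonneg ‖(K₁ᗮ ⊓ K₃).starProjection x‖]

lemma finrank_orthogonal_inf_span_image_le {ι : Type*} [DecidableEq ι] (v : ι → E)
    (S J : Finset ι) (h : S ⊆ J) :
    Module.finrank ℝ ((Submodule.span ℝ (v '' S))ᗮ ⊓ Submodule.span ℝ (v '' J) : Submodule ℝ E) ≤
      (J \ S).card := by
  have hle : Submodule.span ℝ (v '' S) ≤ Submodule.span ℝ (v '' J) :=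
    Submodule.span_mono (Set.image_mono (by exact_mod_cast h))
  have hadd := Submodule.finrank_add_inf_finrank_orthogonal hle
  have hsup : Submodule.span ℝ (v '' J) =
      Submodule.span ℝ (v '' S) ⊔ Submodule.span ℝ (v '' (J \ S : Finset ι)) := by
    rw [← Submodule.span_union, ← Set.image_union, ← Finset.coe_union,
      Finset.union_sdiff_of_subset h]
  have hcard : Module.finrank ℝ (Submodule.span ℝ (v '' (J \ S : Finset ι))) ≤ (J \ S).card := by
    rw [← Finset.coe_image]
    exact (finrank_span_finset_le_card _).trans Finset.card_image_le
  have := Submodule.finrank_add_le_finrank_add_finrank (Submodule.span ℝ (v '' S))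
    (Submodule.span ℝ (v '' (J \ S : Finset ι)))
  rw [← hsup] at this
  omega

end Projection

section Matrix

variable {m ι : Type*} [Fintype m] [Fintype ι]

lemma toLp_eq_starProjection_span_col (X : Matrix m ι ℝ) (J : Finset ι) (v u : m → ℝ)
    (hu : ∃ cf : ι → ℝ, (∀ j ∉ J, cf j = 0) ∧ u = X.mulVec cf)
    (horth : ∀ j ∈ J, ∑ i, (v i - u i) * X i j = 0) :
    (Submodule.span ℝ ((fun j ↦ WithLp.toLp 2 (X.col j)) '' (J : Set ι))).starProjection
      (WithLp.toLp 2 v) = WithLp.toLp 2 u := by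
  obtain ⟨cf, hcf, rfl⟩ := hu
  refine Submodule.eq_starProjection_of_mem_of_inner_eq_zero ?_ fun w hw ↦ ?_
  · have : WithLp.toLp 2 (X.mulVec cf) = ∑ j, cf j • WithLp.toLp 2 (X.col j) := by
      ext i
      simp [Matrix.mulVec, dotProduct, mul_comm]
    rw [this]
    refine Submodule.sum_mem _ fun j _ ↦ ?_
    by_cases hj : j ∈ J
    · exact Submodule.smul_mem _ _ (Submodule.subset_span ⟨j, hj, rfl⟩)
    · simp [hcf j hj]
  · induction hw using Submodule.span_induction with
    | mem w hw =>
      obtain ⟨j, hj, rfl⟩ := hw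
      rw [← horth j hj]
      simp [PiLp.inner_apply, mul_comm]
    | zero => simp
    | add x y _ _ hx hy => rw [inner_add_right, hx, hy, add_zero]
    | smul a x _ hx => rw [inner_smul_right, hx, mul_zero]

end Matrix

section Counting

lemma sum_inv_sq_pow_card_symmDiff_le_one {p : ℕ} (hp : 2 ≤ p) (S : Finset (Fin p)) :
    ∑ J ∈ Finset.univ.erase S, (((p : ℝ) ^ 2)⁻¹) ^ (symmDiff J S).card ≤ 1 := by
  have hp' : (2 : ℝ) ≤ p := by exact_mod_cast hp
  have htotal : ∑ J : Finset (Fin p), (((p : ℝ) ^ 2)⁻¹) ^ (symmDiff J S).card =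
      (((p : ℝ) ^ 2)⁻¹ + 1) ^ p := by
    have hsymm := Equiv.sum_comp (symmDiff_left_involutive S).toPerm
      fun J : Finset (Fin p) ↦ (((p : ℝ) ^ 2)⁻¹) ^ J.card
    simp only [Function.Involutive.coe_toPerm] at hsymm
    rw [hsymm]
    simpa using Fintype.sum_pow_mul_eq_add_pow (Fin p) (((p : ℝ) ^ 2)⁻¹) 1
  have hexp : (((p : ℝ) ^ 2)⁻¹ + 1) ^ p ≤ 2 := by
    calc (((p : ℝ) ^ 2)⁻¹ + 1) ^ p ≤ Real.exp (((p : ℝ) ^ 2)⁻¹) ^ p := by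
          gcongr
          exact Real.add_one_le_exp _
      _ = Real.exp ((p : ℝ)⁻¹) := by
          rw [← Real.exp_nat_mul]
          congr 1
          field_simp
      _ ≤ Real.exp (2⁻¹) := by gcongr
      _ ≤ 2 := by
          have h : Real.exp (2⁻¹) * Real.exp (2⁻¹) = Real.exp 1 := by
            rw [← Real.exp_add]; norm_num
          nlinarith [Real.exp_one_lt_d9, Real.exp_pos (2⁻¹)]
  have herase := Finset.add_sum_erase Finset.univ
    (fun J : Finset (Fin p) ↦ (((p : ℝ) ^ 2)⁻¹) ^ (symmDiff J S).card) (Finset.mem_univ S)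
  simp only [symmDiff_self, Finset.bot_eq_empty, Finset.card_empty, pow_zero] at herase
  linarith

lemma sqrt_two_pow_mul_exp_le {p k d M : ℕ} (hp : 2 ≤ p) (hk : k ≤ M) (hM : 1 ≤ M)
    (hd : d ≤ 2 * M) {c : ℝ} (hc : 0 < c) :
    Real.sqrt 2 ^ k * Real.exp (-((20 + 4 * c) * M * Real.log p / 4)) ≤
      (((p : ℝ) ^ 2)⁻¹) ^ d * (p : ℝ) ^ (-c) := by
  have hp' : (2 : ℝ) ≤ p := by exact_mod_cast hp
  have hp0 : (0 : ℝ) < p := by linarith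
  have hM' : (1 : ℝ) ≤ M := by exact_mod_cast hM
  have hk' : (k : ℝ) ≤ M := by exact_mod_cast hk
  have hd' : (d : ℝ) ≤ 2 * M := by exact_mod_cast hd
  have hlog : 0 < Real.log p := Real.log_pos (by linarith)
  have hpow : Real.sqrt 2 ^ k ≤ Real.exp (Real.log p * k) := by
    rw [mul_comm, Real.exp_nat_mul, Real.exp_log hp0]
    gcongr
    exact (Real.sqrt_le_left (by norm_num)).2 (by norm_num) |>.trans hp'
  calc Real.sqrt 2 ^ k * Real.exp (-((20 + 4 * c) * M * Real.log p / 4))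
      ≤ Real.exp (Real.log p * k) * Real.exp (-((20 + 4 * c) * M * Real.log p / 4)) := by gcongr
    _ = Real.exp (Real.log p * (k - (5 + c) * M)) := by rw [← Real.exp_add]; congr 1; ring
    _ ≤ Real.exp (Real.log p * (-2 * d + -c)) := by
        gcongr
        nlinarith
    _ = (((p : ℝ) ^ 2)⁻¹) ^ d * (p : ℝ) ^ (-c) := by
        rw [← Real.rpow_def_of_pos hp0, Real.rpow_add hp0, Real.rpow_mul hp0.le,
          Real.rpow_natCast, Real.rpow_neg hp0.le 2]
        norm_cast

end Counting

theorem stmt13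
    (n p : ℕ) (hn : 1 ≤ n) (hnp : n ≤ p) (hp2 : 2 ≤ p)
    (X : Matrix (Fin n) (Fin p) ℝ)
    (hX : ∀ j, Real.sqrt (∑ i, (X i j)^2) = Real.sqrt n)
    (σ : ℝ) (hσ : 0 < σ)
    (P : Finset (Fin p) → (Fin n → ℝ) → (Fin n → ℝ))
    (hP : ∀ (J : Finset (Fin p)) (v : Fin n → ℝ),
        (∃ cf : Fin p → ℝ, (∀ j ∉ J, cf j = 0) ∧ P J v = X.mulVec cf)
        ∧ ∀ j ∈ J, (∑ i, (v i - P J v i) * X i j) = 0)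
    (μ : Measure (Fin n → ℝ))
    (hμ : μ = Measure.pi (fun _ : Fin n => gaussianReal 0 (Real.toNNReal (σ^2))))
    (βs : Fin p → ℝ) (sstar : ℕ) (hs1 : 1 ≤ sstar)
    (Jstar : Finset (Fin p)) (hJstar : Jstar = Finset.univ.filter (fun j => βs j ≠ 0))
    (hcard : Jstar.card = sstar)
    (c : ℝ) (hc : 0 < c)
    :
    ENNReal.ofReal (1 - (p : ℝ) ^ (-c)) ≤
      μ {z | ∀ J : Finset (Fin p), J ≠ Jstar →
        ∑ i, z i * (P J z i - P Jstar z i)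
          ≤ (20 + 4 * c) * σ^2 * ((max J.card sstar - (J ∩ Jstar).card : ℕ) : ℝ)
              * Real.log p} := by
  have hproj (J : Finset (Fin p)) (z : Fin n → ℝ) := toLp_eq_starProjection_span_col X J z
    (P J z) (hP J z).1 (hP J z).2
  set V : Finset (Fin p) → Submodule ℝ (EuclideanSpace ℝ (Fin n)) :=
    fun J ↦ Submodule.span ℝ ((fun j ↦ WithLp.toLp 2 (X.col j)) '' (J : Set (Fin p))) with hV
  have hVmono {J K : Finset (Fin p)} (h : J ⊆ K) : V J ≤ V K :=
    Submodule.span_mono (Set.image_mono (by exact_mod_cast h))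
  have hquad (J : Finset (Fin p)) (z : Fin n → ℝ) :
      ∑ i, z i * P J z i = ‖(V J).starProjection (WithLp.toLp 2 z)‖ ^ 2 := by
    have h : inner ℝ (WithLp.toLp 2 z - (V J).starProjection (WithLp.toLp 2 z))
        ((V J).starProjection (WithLp.toLp 2 z)) = 0 :=
      (V J).starProjection_inner_eq_zero _ _ ((V J).starProjection_apply_mem _)
    rw [inner_sub_left, real_inner_self_eq_norm_sq, sub_eq_zero] at h
    rw [← h, hproj J z]
    simp [PiLp.inner_apply, mul_comm]
  set M : Finset (Fin p) → ℕ := fun J ↦ max J.card sstar - (J ∩ Jstar).card with hM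
  set W : Finset (Fin p) → Submodule ℝ (EuclideanSpace ℝ (Fin n)) :=
    fun J ↦ (V (J ∩ Jstar))ᗮ ⊓ V J with hW
  set G : Set (Fin n → ℝ) := {z | ∀ J : Finset (Fin p), J ≠ Jstar →
        ∑ i, z i * (P J z i - P Jstar z i)
          ≤ (20 + 4 * c) * σ^2 * (M J : ℝ) * Real.log p} with hG
  have hbad : Gᶜ ⊆ ⋃ J ∈ Finset.univ.erase Jstar,
      {z | σ ^ 2 * ((20 + 4 * c) * M J * Real.log p) <
        ‖(W J).starProjection (WithLp.toLp 2 z)‖ ^ 2} := by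
    intro z hz
    simp only [hG, Set.mem_compl_iff, Set.mem_ofPred_eq, not_forall, not_le] at hz
    obtain ⟨J, hJ, hlt⟩ := hz
    simp only [Set.mem_iUnion, Set.mem_ofPred_eq]
    refine ⟨J, Finset.mem_erase.2 ⟨hJ, Finset.mem_univ _⟩, ?_⟩
    simp only [mul_sub, Finset.sum_sub_distrib, hquad] at hlt
    have := norm_sq_starProjection_sub_le (hVmono (Finset.inter_subset_left (s₁ := J) (s₂ := Jstar)))
      (hVmono (Finset.inter_subset_right (s₁ := J) (s₂ := Jstar))) (WithLp.toLp 2 z)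
    linarith
  have hterm (J : Finset (Fin p)) (hJ : J ∈ Finset.univ.erase Jstar) :
      μ {z | σ ^ 2 * ((20 + 4 * c) * M J * Real.log p) <
        ‖(W J).starProjection (WithLp.toLp 2 z)‖ ^ 2} ≤
      ENNReal.ofReal ((((p : ℝ) ^ 2)⁻¹) ^ (symmDiff J Jstar).card * (p : ℝ) ^ (-c)) := by
    rw [hμ]
    refine (pi_gaussianReal_lt_norm_sq_starProjection_le hσ (W J) _).trans
      (ENNReal.ofReal_le_ofReal ?_)
    have hfin := finrank_orthogonal_inf_span_image_le (fun j ↦ WithLp.toLp 2 (X.col j))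
      (J ∩ Jstar) J Finset.inter_subset_left
    have h₁ := Finset.card_sdiff_add_card_inter J Jstar
    have h₂ := Finset.card_sdiff_add_card_inter Jstar J
    have hsymm : (symmDiff J Jstar).card = (J \ Jstar).card + (Jstar \ J).card :=
      Finset.card_union_of_disjoint disjoint_sdiff_sdiff
    have hpos : 0 < (symmDiff J Jstar).card := by
      rw [Finset.card_pos, Finset.nonempty_iff_ne_empty, ← Finset.bot_eq_empty, Ne,
        symmDiff_eq_bot]
      exact Finset.ne_of_mem_erase hJ
    rw [Finset.inter_comm] at h₂
    rw [Finset.sdiff_inter_self_left] at hfin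
    have hMeq : M J = max J.card sstar - (J ∩ Jstar).card := rfl
    refine sqrt_two_pow_mul_exp_le hp2 (hfin.trans ?_) ?_ ?_ hc <;> omega
  have hsum : μ Gᶜ ≤ ENNReal.ofReal ((p : ℝ) ^ (-c)) := by
    refine (measure_mono hbad).trans <| (measure_biUnion_finset_le _ _).trans <|
      (Finset.sum_le_sum hterm).trans ?_
    rw [← ENNReal.ofReal_sum_of_nonneg (fun _ _ ↦ by positivity), ← Finset.sum_mul]
    refine ENNReal.ofReal_le_ofReal (mul_le_of_le_one_left (by positivity) ?_)
    exact sum_inv_sq_pow_card_symmDiff_le_one hp2 Jstar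
  have hprob : IsProbabilityMeasure μ := by rw [hμ]; infer_instance
  rw [ENNReal.ofReal_sub _ (by positivity), ENNReal.ofReal_one, tsub_le_iff_right]
  calc (1 : ℝ≥0∞) = μ (G ∪ Gᶜ) := by rw [Set.union_compl_self, measure_univ]
    _ ≤ μ G + μ Gᶜ := measure_union_le _ _
    _ ≤ _ := by gcongr
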